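/- arXiv:2307.08522 — 2 statements merged into one kernel-verified Lean document; each statement's English description precedes it below -/
import Mathlib

section
/- Let Λ₁, Λ₂, Λ₃, Ω be real constants with Λ₂ + 2Ω ≠ 0 and β > 0. Suppose u, v, w : ℝ⁴ → ℝ are C², satisfy at every point the linear system Λ₁ u_x + (Λ₂ + 2Ω) u_y + (Λ₃ + β y) u_z = 0, Λ₁ v_x + (Λ₂ + 2Ω) v_y + (Λ₃ + β y) v_z = 0, Λ₁ w_x + (Λ₂ + 2Ω) w_y + (Λ₃ + β y) w_z − β v = 0, together with the mass conservation condition u_x + v_y + w_z = 0 and the constant-vorticity condition (w_y − v_z, u_z − w_x, v_x − u_y) = (Λ₁, Λ₂, Λ₃). Then Λ₃ = 0, and there exist functions a, b : ℝ → ℝ such that u(x,y,z,t) = a(t), v(x,y,z,t) = 2Ω Λ₁/β, and w(x,y,z,t) = b(t) − Λ₂ x + Λ₁ y for all (x,y,z,t) ∈ ℝ⁴. -/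
/-- Partial derivative in the `x` direction on `ℝ⁴` with coordinates `(x,y,z,t)`. -/
noncomputable def pX (f : ℝ × ℝ × ℝ × ℝ → ℝ) (p : ℝ × ℝ × ℝ × ℝ) : ℝ :=
  fderiv ℝ f p (1, 0, 0, 0)

/-- Partial derivative in the `y` direction. -/
noncomputable def pY (f : ℝ × ℝ × ℝ × ℝ → ℝ) (p : ℝ × ℝ × ℝ × ℝ) : ℝ :=
  fderiv ℝ f p (0, 1, 0, 0)

/-- Partial derivative in the `z` direction. -/
noncomputable def pZ (f : ℝ × ℝ × ℝ × ℝ → ℝ) (p : ℝ × ℝ × ℝ × ℝ) : ℝ :=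
  fderiv ℝ f p (0, 0, 1, 0)

/-- Partial derivative in the `t` direction. -/
noncomputable def pT (f : ℝ × ℝ × ℝ × ℝ → ℝ) (p : ℝ × ℝ × ℝ × ℝ) : ℝ :=
  fderiv ℝ f p (0, 0, 0, 1)

/-- The directional derivative of a first-order partial derivative of a `C²` function. -/
theorem hasFDerivAt_fderiv_apply {E : Type*} [NormedAddCommGroup E] [NormedSpace ℝ E]
    {f : E → ℝ} (hf : ContDiff ℝ 2 f) (a p : E) :
    HasFDerivAt (fun q => fderiv ℝ f q a) ((fderiv ℝ (fderiv ℝ f) p).flip a) p := by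
  have h : DifferentiableAt ℝ (fderiv ℝ f) p :=
    ((hf.fderiv_right (m := 1) (by norm_num)).differentiable (by norm_num)) p
  exact (h.hasFDerivAt.clm_apply (hasFDerivAt_const a p)).congr_fderiv (by ext x; simp)

theorem fderiv_fderiv_comm {E : Type*} [NormedAddCommGroup E] [NormedSpace ℝ E]
    {f : E → ℝ} (hf : ContDiff ℝ 2 f) (p a b : E) :
    fderiv ℝ (fderiv ℝ f) p a b = fderiv ℝ (fderiv ℝ f) p b a :=
  (hf.contDiffAt.isSymmSndFDerivAt (by simp)).eq a b

/-- Differentiating a transport equation whose `z`-speed is affine in `y`. -/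
theorem fderiv_transport {f g : ℝ × ℝ × ℝ × ℝ → ℝ} (hf : ContDiff ℝ 2 f)
    (hg : Differentiable ℝ g) (l c m β : ℝ)
    (h : ∀ p, l * pX f p + c * pY f p + (m + β * p.2.1) * pZ f p - g p = 0)
    (p d : ℝ × ℝ × ℝ × ℝ) :
    l * fderiv ℝ (fderiv ℝ f) p d (1, 0, 0, 0) + c * fderiv ℝ (fderiv ℝ f) p d (0, 1, 0, 0)
      + (m + β * p.2.1) * fderiv ℝ (fderiv ℝ f) p d (0, 0, 1, 0) + β * d.2.1 * pZ f p
      = fderiv ℝ g p d := by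
  have hs : HasFDerivAt (fun q : ℝ × ℝ × ℝ × ℝ => q.2) (ContinuousLinearMap.snd ℝ _ _) p :=
    hasFDerivAt_snd
  have hy := (hs.fst.const_mul β).const_add m
  have key := (((((hasFDerivAt_fderiv_apply hf (1, 0, 0, 0) p).const_mul l).add
    ((hasFDerivAt_fderiv_apply hf (0, 1, 0, 0) p).const_mul c)).add
    (hy.mul (hasFDerivAt_fderiv_apply hf (0, 0, 1, 0) p))).sub (hg p).hasFDerivAt)
  have h0 := key.unique ((hasFDerivAt_const (0 : ℝ) p).congr_of_eventuallyEq
    (Filter.Eventually.of_forall h))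
  have h1 := DFunLike.congr_fun h0 d
  simp at h1
  unfold pZ
  linear_combination h1

/-- Differentiating a relation saying that a difference of two first-order partial derivatives
is constant. -/
theorem fderiv_fderiv_eq_of_sub_eq_const {E : Type*} [NormedAddCommGroup E] [NormedSpace ℝ E]
    {f g : E → ℝ} (hf : ContDiff ℝ 2 f) (hg : ContDiff ℝ 2 g) {a b : E} {k : ℝ}
    (h : ∀ p, fderiv ℝ f p a - fderiv ℝ g p b = k) (p d : E) :
    fderiv ℝ (fderiv ℝ f) p d a = fderiv ℝ (fderiv ℝ g) p d b := by
  have h0 := ((hasFDerivAt_fderiv_apply hf a p).sub (hasFDerivAt_fderiv_apply hg b p)).unique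
    ((hasFDerivAt_const k p).congr_of_eventuallyEq (Filter.Eventually.of_forall h))
  have h1 := DFunLike.congr_fun h0 d
  simp at h1
  linarith

theorem fderiv_fderiv_eq_zero_of_eq_const {E : Type*} [NormedAddCommGroup E] [NormedSpace ℝ E]
    {f : E → ℝ} (hf : ContDiff ℝ 2 f) {a : E} {k : ℝ}
    (h : ∀ p, fderiv ℝ f p a = k) (p d : E) :
    fderiv ℝ (fderiv ℝ f) p d a = 0 := by
  simpa using DFunLike.congr_fun ((hasFDerivAt_fderiv_apply hf a p).unique
    ((hasFDerivAt_const k p).congr_of_eventuallyEq (Filter.Eventually.of_forall h))) d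

/-- A function whose spatial partial derivatives are constants is affine in space. -/
theorem eq_add_of_spatial_partials_const {f : ℝ × ℝ × ℝ × ℝ → ℝ} (hf : Differentiable ℝ f)
    {k l m : ℝ} (hx : ∀ p, pX f p = k) (hy : ∀ p, pY f p = l) (hz : ∀ p, pZ f p = m)
    (p : ℝ × ℝ × ℝ × ℝ) :
    f p = f (0, 0, 0, p.2.2.2) + k * p.1 + l * p.2.1 + m * p.2.2.1 := by
  obtain ⟨x, y, z, t⟩ := p
  have hγ (s : ℝ) : HasDerivAt (fun r : ℝ => ((r * x, r * y, r * z, t) : ℝ × ℝ × ℝ × ℝ))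
      (x, y, z, 0) s :=
    (hasDerivAt_mul_const x).prodMk ((hasDerivAt_mul_const y).prodMk
      ((hasDerivAt_mul_const z).prodMk (hasDerivAt_const s t)))
  have hlin (q : ℝ × ℝ × ℝ × ℝ) : fderiv ℝ f q (x, y, z, 0) = k * x + l * y + m * z := by
    have e : ((x, y, z, 0) : ℝ × ℝ × ℝ × ℝ)
        = x • (1, 0, 0, 0) + y • (0, 1, 0, 0) + z • (0, 0, 1, 0) := by simp
    rw [e, map_add, map_add, map_smul, map_smul, map_smul]
    change x * pX f q + y * pY f q + z * pZ f q = _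
    rw [hx, hy, hz]
    ring
  have hd (s : ℝ) : HasDerivAt
      (fun r : ℝ => f (r * x, r * y, r * z, t) - r * (k * x + l * y + m * z)) 0 s := by
    have h := ((hf _).hasFDerivAt.comp_hasDerivAt s (hγ s)).sub
      (hasDerivAt_mul_const (x := s) (k * x + l * y + m * z))
    rw [hlin, sub_self] at h
    exact h
  have hc := is_const_of_deriv_eq_zero (fun s => (hd s).differentiableAt)
    (fun s => (hd s).deriv) 1 0
  simp only [one_mul, zero_mul, sub_zero] at hc
  simp only
  linarith

/-- Constant-vorticity solutions of the linear system with mass conservation have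
the explicit form `u = a(t)`, `v = 2ΩΛ₁/β`, `w = b(t) − Λ₂x + Λ₁y`, and `Λ₃ = 0`. -/
theorem linear_system_solution (Λ₁ Λ₂ Λ₃ Ω β : ℝ) (hΩ : Λ₂ + 2 * Ω ≠ 0) (hβ : 0 < β)
    (u v w : ℝ × ℝ × ℝ × ℝ → ℝ)
    (hu : ContDiff ℝ 2 u) (hv : ContDiff ℝ 2 v) (hw : ContDiff ℝ 2 w)
    (hlin1 : ∀ p : ℝ × ℝ × ℝ × ℝ,
      Λ₁ * pX u p + (Λ₂ + 2 * Ω) * pY u p + (Λ₃ + β * p.2.1) * pZ u p = 0)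
    (hlin2 : ∀ p : ℝ × ℝ × ℝ × ℝ,
      Λ₁ * pX v p + (Λ₂ + 2 * Ω) * pY v p + (Λ₃ + β * p.2.1) * pZ v p = 0)
    (hlin3 : ∀ p : ℝ × ℝ × ℝ × ℝ,
      Λ₁ * pX w p + (Λ₂ + 2 * Ω) * pY w p + (Λ₃ + β * p.2.1) * pZ w p - β * v p = 0)
    (hmass : ∀ p : ℝ × ℝ × ℝ × ℝ, pX u p + pY v p + pZ w p = 0)
    (hvort1 : ∀ p : ℝ × ℝ × ℝ × ℝ, pY w p - pZ v p = Λ₁)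
    (hvort2 : ∀ p : ℝ × ℝ × ℝ × ℝ, pZ u p - pX w p = Λ₂)
    (hvort3 : ∀ p : ℝ × ℝ × ℝ × ℝ, pX v p - pY u p = Λ₃) :
    Λ₃ = 0 ∧ ∃ a b : ℝ → ℝ, ∀ p : ℝ × ℝ × ℝ × ℝ,
      u p = a p.2.2.2 ∧
      v p = 2 * Ω * Λ₁ / β ∧
      w p = b p.2.2.2 - Λ₂ * p.1 + Λ₁ * p.2.1 := by
  have hdu : Differentiable ℝ u := hu.differentiable (by norm_num)
  have hdv : Differentiable ℝ v := hv.differentiable (by norm_num)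
  have hdw : Differentiable ℝ w := hw.differentiable (by norm_num)
  have tu := fderiv_transport (g := fun _ => 0) hu (by fun_prop) Λ₁ (Λ₂ + 2 * Ω) Λ₃ β
    (by simpa using hlin1)
  have tv := fderiv_transport (g := fun _ => 0) hv (by fun_prop) Λ₁ (Λ₂ + 2 * Ω) Λ₃ β
    (by simpa using hlin2)
  have tw := fderiv_transport (g := fun p => β * v p) hw (by fun_prop) Λ₁ (Λ₂ + 2 * Ω) Λ₃ β hlin3
  have hβv (p d : ℝ × ℝ × ℝ × ℝ) :
      fderiv ℝ (fun p => β * v p) p d = β * fderiv ℝ v p d := by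
    rw [fderiv_const_mul (hdv p)]
    simp
  simp only [hβv] at tw
  simp only [fderiv_fun_const, Pi.zero_apply, zero_apply] at tu tv
  have c1 := fderiv_fderiv_eq_of_sub_eq_const hw hv hvort1
  have c2 := fderiv_fderiv_eq_of_sub_eq_const hu hw hvort2
  have c3 := fderiv_fderiv_eq_of_sub_eq_const hv hu hvort3
  have su := fderiv_fderiv_comm hu
  have sv := fderiv_fderiv_comm hv
  have sw := fderiv_fderiv_comm hw
  have hwz (p) : pZ w p = pY v p := by
    apply mul_left_cancel₀ hβ.ne'
    have h1 := tw p (0, 1, 0, 0)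
    have h2 := tv p (0, 0, 1, 0)
    rw [sw, c1, sw p _ (0, 0, 1, 0), c1, c1, sv p _ (0, 0, 1, 0), sv p _ (0, 0, 1, 0)] at h1
    change _ = β * pY v p at h1
    simp only [mul_one, mul_zero, zero_mul, add_zero] at h1 h2
    linear_combination h1 - h2
  have hvx (p) : pX v p = 0 := by
    apply mul_left_cancel₀ hβ.ne'
    have h1 := tw p (1, 0, 0, 0)
    have h2 := tu p (0, 0, 1, 0)
    rw [su, c2, su p _ (0, 1, 0, 0), c2, c2, sw p _ (1, 0, 0, 0), sw p (0, 0, 1, 0)] at h2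
    change _ = β * pX v p at h1
    simp only [mul_zero, zero_mul, add_zero] at h1 h2
    rw [sw p _ (0, 1, 0, 0)] at h1
    linear_combination h2 - h1
  have huz (p) : pZ u p = 0 := by
    apply mul_left_cancel₀ hβ.ne'
    have h1 := tv p (1, 0, 0, 0)
    have h2 := tu p (0, 1, 0, 0)
    rw [sv p _ (0, 1, 0, 0), sv p _ (0, 0, 1, 0), c3, c3, c3] at h1
    rw [su p _ (1, 0, 0, 0), su p _ (0, 0, 1, 0)] at h2
    simp only [mul_one, mul_zero, zero_mul, add_zero] at h1 h2
    linear_combination h2 - h1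
  have huy (p) : pY u p = -Λ₃ := by linarith [hvort3 p, hvx p]
  have hux (p) : pX u p = -2 * pY v p := by linarith [hmass p, hwz p]
  have hvy' (p d) : -2 * fderiv ℝ (fderiv ℝ v) p d (0, 1, 0, 0)
      = fderiv ℝ (fderiv ℝ u) p d (1, 0, 0, 0) := by
    have h := ((hasFDerivAt_fderiv_apply hv (0, 1, 0, 0) p).const_mul (-2)).unique
      ((hasFDerivAt_fderiv_apply hu (1, 0, 0, 0) p).congr_of_eventuallyEq
        (Filter.Eventually.of_forall fun q => (hux q).symm))
    simpa using DFunLike.congr_fun h d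
  have hvz (p) : pZ v p = 0 := by
    have h := tv p (0, 1, 0, 0)
    have h1 := hvy' p (0, 1, 0, 0)
    have h2 := hvy' p (0, 0, 1, 0)
    rw [su, fderiv_fderiv_eq_zero_of_eq_const hu huy] at h1
    rw [su, fderiv_fderiv_eq_zero_of_eq_const hu huz] at h2
    have h3 := fderiv_fderiv_eq_zero_of_eq_const hv hvx p (0, 1, 0, 0)
    rw [h3, sv p _ (0, 0, 1, 0)] at h
    apply mul_left_cancel₀ hβ.ne'
    simp only [mul_one, mul_zero] at h ⊢
    linear_combination h + (Λ₂ + 2 * Ω) / 2 * h1 + (Λ₃ + β * p.2.1) / 2 * h2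
  have hvy (p) : pY v p = 0 := by
    apply mul_left_cancel₀ hΩ
    linear_combination hlin2 p - Λ₁ * hvx p - (Λ₃ + β * p.2.1) * hvz p
  have hux0 (p) : pX u p = 0 := by rw [hux, hvy, mul_zero]
  have hΛ₃ : Λ₃ = 0 := by
    apply mul_left_cancel₀ hΩ
    have h := hlin1 0
    rw [hux0, huy, huz] at h
    linear_combination -h
  have huy0 (p) : pY u p = 0 := by rw [huy, hΛ₃, neg_zero]
  have hwx (p) : pX w p = -Λ₂ := by linarith [hvort2 p, huz p]
  have hwy (p) : pY w p = Λ₁ := by linarith [hvort1 p, hvz p]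
  have hwz0 (p) : pZ w p = 0 := by rw [hwz, hvy]
  refine ⟨hΛ₃, fun t => u (0, 0, 0, t), fun t => w (0, 0, 0, t), fun p => ⟨?_, ?_, ?_⟩⟩
  · simpa using eq_add_of_spatial_partials_const hdu hux0 huy0 huz p
  · have h := hlin3 p
    rw [hwx, hwy, hwz0] at h
    rw [eq_div_iff hβ.ne']
    linear_combination -h
  · have h := eq_add_of_spatial_partials_const hdw hwx hwy hwz0 p
    linear_combination h
end

section
/- (Theorem 1, original form.) Let Ω, R, g, d be real constants, β > 0, ρ₁ > 0, and let Λ₁, Λ₂, Λ₃ be real constants with Λ₂ + 2Ω ≠ 0. Suppose u₁, v₁, w₁ : ℝ⁴ → ℝ are C² and P₁ : ℝ⁴ → ℝ is C², satisfying: (i) the β-plane governing equations with Coriolis and centripetal forces u_t + u u_x + v u_y + w u_z + 2Ω w − β y v = −(P₁)_x/ρ₁, v_t + u v_x + v v_y + w v_z + β y u + Ω² y = −(P₁)_y/ρ₁, w_t + u w_x + v w_y + w w_z − 2Ω u − Ω² R = −(P₁)_z/ρ₁ − g (with (u,v,w) = (u₁,v₁,w₁)); (ii) mass conservation u_x + v_y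 + w_z = 0; (iii) constant vorticity (w_y − v_z, u_z − w_x, v_x − u_y) = (Λ₁, Λ₂, Λ₃); (iv) the flat-bottom condition w₁(x, y, −d, t) = 0 for all x, y, t. Assume there is a differentiable surface η₁ : ℝ³ → ℝ (function of (x,y,t)) with |∂_y η₁| bounded, such that for each fixed (x,t) the function y ↦ (P₁)_y + (P₁)_z · ∂_y η₁ evaluated at z = η₁(x,y,t) is bounded on ℝ. Then u₁ ≡ −Ω²/β, v₁ ≡ 0, w₁ ≡ 0, and there exists c₁ : ℝ → ℝ with P₁(x,y,z,t) = ρ₁ [ (Ω² R − g − 2Ω³/β) z + c₁(t) ]. -/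
/-- Partial derivative in the `y` direction on `ℝ³` with coordinates `(x,y,t)`. -/
noncomputable def sY (η : ℝ × ℝ × ℝ → ℝ) (q : ℝ × ℝ × ℝ) : ℝ :=
  fderiv ℝ η q (0, 1, 0)

/-- Symmetry of second directional derivatives. -/
theorem fderiv_apply_comm {E : Type*} [NormedAddCommGroup E] [NormedSpace ℝ E] {f : E → ℝ}
    (hf : ContDiff ℝ 2 f) (p a b : E) :
    fderiv ℝ (fun q => fderiv ℝ f q a) p b = fderiv ℝ (fun q => fderiv ℝ f q b) p a := by
  have hd : DifferentiableAt ℝ (fderiv ℝ f) p :=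
    ((hf.fderiv_right (m := 1) (by norm_num)).differentiable (by norm_num)) p
  have hs : IsSymmSndFDerivAt ℝ f p := hf.contDiffAt.isSymmSndFDerivAt (by simp)
  have key : ∀ c e : E, fderiv ℝ (fun q => fderiv ℝ f q c) p e = fderiv ℝ (fderiv ℝ f) p e c := by
    intro c e
    rw [fderiv_clm_apply hd (differentiableAt_const c)]
    simp
  rw [key, key]
  exact hs b a

theorem differentiable_fderiv_apply {E : Type*} [NormedAddCommGroup E] [NormedSpace ℝ E]
    {f : E → ℝ} (hf : ContDiff ℝ 2 f) (a : E) : Differentiable ℝ (fun q => fderiv ℝ f q a) :=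
  ((hf.fderiv_right (m := 1) (by norm_num)).differentiable (by norm_num)).clm_apply
    (differentiable_const a)

/-- Directional derivative of an equation of momentum type. -/
theorem fderiv_momentum {T u X v Y w Z m n Q : ℝ × ℝ × ℝ × ℝ → ℝ} {c₁ c₂ c₃ c₄ c₅ : ℝ}
    (hT : Differentiable ℝ T) (hu : Differentiable ℝ u) (hX : Differentiable ℝ X)
    (hv : Differentiable ℝ v) (hY : Differentiable ℝ Y) (hw : Differentiable ℝ w)
    (hZ : Differentiable ℝ Z) (hm : Differentiable ℝ m) (hn : Differentiable ℝ n)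
    (hQ : Differentiable ℝ Q)
    (h : ∀ p, T p + u p * X p + v p * Y p + w p * Z p + c₁ * m p + c₂ * (p.2.1 * n p)
      + c₃ * p.2.1 + c₄ = c₅ * Q p) (p e : ℝ × ℝ × ℝ × ℝ) :
    fderiv ℝ T p e + (u p * fderiv ℝ X p e + X p * fderiv ℝ u p e)
      + (v p * fderiv ℝ Y p e + Y p * fderiv ℝ v p e)
      + (w p * fderiv ℝ Z p e + Z p * fderiv ℝ w p e) + c₁ * fderiv ℝ m p e
      + c₂ * (p.2.1 * fderiv ℝ n p e + n p * e.2.1) + c₃ * e.2.1 = c₅ * fderiv ℝ Q p e := by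
  have hy : HasFDerivAt (fun q : ℝ × ℝ × ℝ × ℝ => q.2.1)
      ((ContinuousLinearMap.fst ℝ ℝ (ℝ × ℝ)).comp (ContinuousLinearMap.snd ℝ ℝ (ℝ × ℝ × ℝ))) p :=
    ((ContinuousLinearMap.fst ℝ ℝ (ℝ × ℝ)).comp
      (ContinuousLinearMap.snd ℝ ℝ (ℝ × ℝ × ℝ))).hasFDerivAt
  have hl := (((((((hT p).hasFDerivAt.add ((hu p).hasFDerivAt.mul (hX p).hasFDerivAt)).add
    ((hv p).hasFDerivAt.mul (hY p).hasFDerivAt)).add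
    ((hw p).hasFDerivAt.mul (hZ p).hasFDerivAt)).add ((hm p).hasFDerivAt.const_mul c₁)).add
    ((hy.mul (hn p).hasFDerivAt).const_mul c₂)).add (hy.const_mul c₃)).add_const c₄
  have hr := (hQ p).hasFDerivAt.const_mul c₅
  have := congrArg (fun L => L e) ((hl.congr_of_eventuallyEq
    (Filter.Eventually.of_forall fun q => (h q).symm)).unique hr)
  simpa [mul_add] using this

/-- Directional derivative of a transport equation along the total vorticity field. -/
theorem fderiv_transport_s8 {X Y Z V : ℝ × ℝ × ℝ × ℝ → ℝ} {A B C b c : ℝ}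
    (hX : Differentiable ℝ X) (hY : Differentiable ℝ Y) (hZ : Differentiable ℝ Z)
    (hV : Differentiable ℝ V)
    (h : ∀ p, A * X p + B * Y p + (C + b * p.2.1) * Z p = c * V p) (p e : ℝ × ℝ × ℝ × ℝ) :
    A * fderiv ℝ X p e + B * fderiv ℝ Y p e + (C + b * p.2.1) * fderiv ℝ Z p e
      + b * e.2.1 * Z p = c * fderiv ℝ V p e := by
  have h0 : Differentiable ℝ (fun _ : ℝ × ℝ × ℝ × ℝ => (0 : ℝ)) := differentiable_const 0
  have := fderiv_momentum (T := fun q => A * X q) (u := fun _ => 0) (X := fun _ => 0)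
    (v := fun _ => B) (Y := Y) (w := fun _ => C) (Z := Z) (m := fun _ => 0) (n := Z) (Q := V)
    (c₁ := 0) (c₂ := b) (c₃ := 0) (c₄ := 0) (c₅ := c) (hX.const_mul A) h0 h0
    (differentiable_const B) hY (differentiable_const C) hZ h0 hZ hV
    (fun q => by linear_combination h q) p e
  have hA : fderiv ℝ (fun q => A * X q) p e = A * fderiv ℝ X p e := by
    rw [fderiv_const_mul (hX p)]; simp
  rw [hA] at this
  simp only [fderiv_fun_const, Pi.zero_apply, zero_apply] at this
  linear_combination this

theorem fderiv_sub_eq_const {E : Type*} [NormedAddCommGroup E] [NormedSpace ℝ E] {f g : E → ℝ}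
    {c : ℝ} (h : ∀ p, f p - g p = c)
    (p e : E) : fderiv ℝ f p e = fderiv ℝ g p e := by
  have hfg : f = fun q => g q + c := funext fun q => by linarith [h q]
  rw [hfg, fderiv_add_const]

theorem fderiv_apply_of_forall_eq {E : Type*} [NormedAddCommGroup E] [NormedSpace ℝ E]
    {f : E → ℝ} {c : ℝ} (h : ∀ p, f p = c) (p e : E) : fderiv ℝ f p e = 0 := by
  have hf : f = fun _ => c := funext h
  rw [hf]; simp

/-- The directional derivative vanishes in directions along which the function vanishes. -/
theorem fderiv_apply_eq_zero_of_line {E : Type*} [NormedAddCommGroup E] [NormedSpace ℝ E]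
    {f : E → ℝ} (hf : Differentiable ℝ f) (p e : E) (h : ∀ s : ℝ, f (p + s • e) = 0) :
    fderiv ℝ f p e = 0 := by
  rw [← (hf p).lineDeriv_eq_fderiv]
  simp [lineDeriv, h]

/-- A function with vanishing spatial derivatives depends on time only. -/
theorem eq_of_spatial_derivs_eq_zero {f : ℝ × ℝ × ℝ × ℝ → ℝ} (hf : Differentiable ℝ f)
    (hx : ∀ p, pX f p = 0) (hy : ∀ p, pY f p = 0) (hz : ∀ p, pZ f p = 0) (x y z t : ℝ) :
    f (x, y, z, t) = f (0, 0, 0, t) := by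
  have hd : ∀ s : ℝ, HasDerivAt (fun s : ℝ => f (s * x, s * y, s * z, t)) 0 s := by
    intro s
    have hline : HasDerivAt (fun s : ℝ => (s * x, s * y, s * z, t)) (x, y, z, (0 : ℝ)) s :=
      (hasDerivAt_mul_const x).prodMk ((hasDerivAt_mul_const y).prodMk
        ((hasDerivAt_mul_const z).prodMk (hasDerivAt_const s t)))
    have hcomp := (hf (s * x, s * y, s * z, t)).hasFDerivAt.comp_hasDerivAt s hline
    have hdir : ((x, y, z, 0) : ℝ × ℝ × ℝ × ℝ)
        = x • (1, 0, 0, 0) + y • (0, 1, 0, 0) + z • (0, 0, 1, 0) := by simp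
    have hval : fderiv ℝ f (s * x, s * y, s * z, t) (x, y, z, 0) = 0 := by
      rw [hdir, map_add, map_add, map_smul, map_smul, map_smul]
      have h1 := hx (s * x, s * y, s * z, t)
      have h2 := hy (s * x, s * y, s * z, t)
      have h3 := hz (s * x, s * y, s * z, t)
      simp only [pX, pY, pZ] at h1 h2 h3
      rw [h1, h2, h3]; simp
    rwa [hval] at hcomp
  have := is_const_of_deriv_eq_zero (fun s => (hd s).differentiableAt) (fun s => (hd s).deriv) 1 0
  simpa using this

/-- An affine function that stays bounded has zero slope. -/
theorem eq_zero_of_abs_mul_le {c M : ℝ} (h : ∀ y : ℝ, |c * y| ≤ M) : c = 0 := by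
  by_contra hc
  have := h ((M + 1) / c)
  rw [mul_div_cancel₀ _ hc] at this
  linarith [le_abs_self (M + 1)]

/-- Theorem 1 (original form): a constant-vorticity solution of the β-plane governing
equations with Coriolis and centripetal forces over a flat bed, whose pressure has bounded
`y`-variation along the free surface, is the uniform zonal flow `u₁ ≡ −Ω²/β`, `v₁ ≡ 0`,
`w₁ ≡ 0` with pressure `P₁ = ρ₁[(Ω²R − g − 2Ω³/β)z + c₁(t)]`. -/
theorem theorem1_original (Ω R g d β ρ₁ : ℝ) (hβ : 0 < β) (hρ : 0 < ρ₁)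
    (Λ₁ Λ₂ Λ₃ : ℝ) (hΩ : Λ₂ + 2 * Ω ≠ 0)
    (u₁ v₁ w₁ P₁ : ℝ × ℝ × ℝ × ℝ → ℝ)
    (hu : ContDiff ℝ 2 u₁) (hv : ContDiff ℝ 2 v₁) (hw : ContDiff ℝ 2 w₁)
    (hP : ContDiff ℝ 2 P₁)
    (heq1 : ∀ p : ℝ × ℝ × ℝ × ℝ,
      pT u₁ p + u₁ p * pX u₁ p + v₁ p * pY u₁ p + w₁ p * pZ u₁ p + 2 * Ω * w₁ p
        - β * p.2.1 * v₁ p = -(pX P₁ p) / ρ₁)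
    (heq2 : ∀ p : ℝ × ℝ × ℝ × ℝ,
      pT v₁ p + u₁ p * pX v₁ p + v₁ p * pY v₁ p + w₁ p * pZ v₁ p + β * p.2.1 * u₁ p
        + Ω ^ 2 * p.2.1 = -(pY P₁ p) / ρ₁)
    (heq3 : ∀ p : ℝ × ℝ × ℝ × ℝ,
      pT w₁ p + u₁ p * pX w₁ p + v₁ p * pY w₁ p + w₁ p * pZ w₁ p - 2 * Ω * u₁ p
        - Ω ^ 2 * R = -(pZ P₁ p) / ρ₁ - g)
    (hmass : ∀ p : ℝ × ℝ × ℝ × ℝ, pX u₁ p + pY v₁ p + pZ w₁ p = 0)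
    (hvort1 : ∀ p : ℝ × ℝ × ℝ × ℝ, pY w₁ p - pZ v₁ p = Λ₁)
    (hvort2 : ∀ p : ℝ × ℝ × ℝ × ℝ, pZ u₁ p - pX w₁ p = Λ₂)
    (hvort3 : ∀ p : ℝ × ℝ × ℝ × ℝ, pX v₁ p - pY u₁ p = Λ₃)
    (hbot : ∀ x y t : ℝ, w₁ (x, y, -d, t) = 0)
    (η₁ : ℝ × ℝ × ℝ → ℝ) (hη : Differentiable ℝ η₁)
    (hηy : ∃ M : ℝ, ∀ q : ℝ × ℝ × ℝ, |sY η₁ q| ≤ M)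
    (hbound : ∀ x t : ℝ, ∃ M : ℝ, ∀ y : ℝ,
      |pY P₁ (x, y, η₁ (x, y, t), t)
        + pZ P₁ (x, y, η₁ (x, y, t), t) * sY η₁ (x, y, t)| ≤ M) :
    (∀ p : ℝ × ℝ × ℝ × ℝ, u₁ p = -(Ω ^ 2) / β) ∧
    (∀ p : ℝ × ℝ × ℝ × ℝ, v₁ p = 0) ∧
    (∀ p : ℝ × ℝ × ℝ × ℝ, w₁ p = 0) ∧
    ∃ c₁ : ℝ → ℝ, ∀ p : ℝ × ℝ × ℝ × ℝ,
      P₁ p = ρ₁ * ((Ω ^ 2 * R - g - 2 * Ω ^ 3 / β) * p.2.2.1 + c₁ p.2.2.2) := by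
  have du := hu.differentiable (by norm_num)
  have dv := hv.differentiable (by norm_num)
  have dw := hw.differentiable (by norm_num)
  have dP := hP.differentiable (by norm_num)
  have dX : ∀ {f}, ContDiff ℝ 2 f → Differentiable ℝ (pX f) :=
    fun hf => differentiable_fderiv_apply hf _
  have dY : ∀ {f}, ContDiff ℝ 2 f → Differentiable ℝ (pY f) :=
    fun hf => differentiable_fderiv_apply hf _
  have dZ : ∀ {f}, ContDiff ℝ 2 f → Differentiable ℝ (pZ f) :=
    fun hf => differentiable_fderiv_apply hf _
  have dT : ∀ {f}, ContDiff ℝ 2 f → Differentiable ℝ (pT f) :=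
    fun hf => differentiable_fderiv_apply hf _
  have cYX : ∀ {f}, ContDiff ℝ 2 f → ∀ p, pY (pX f) p = pX (pY f) p :=
    fun hf p => fderiv_apply_comm hf p _ _
  have cZX : ∀ {f}, ContDiff ℝ 2 f → ∀ p, pZ (pX f) p = pX (pZ f) p :=
    fun hf p => fderiv_apply_comm hf p _ _
  have cZY : ∀ {f}, ContDiff ℝ 2 f → ∀ p, pZ (pY f) p = pY (pZ f) p :=
    fun hf p => fderiv_apply_comm hf p _ _
  have cXT : ∀ {f}, ContDiff ℝ 2 f → ∀ p, pX (pT f) p = pT (pX f) p :=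
    fun hf p => fderiv_apply_comm hf p _ _
  have cYT : ∀ {f}, ContDiff ℝ 2 f → ∀ p, pY (pT f) p = pT (pY f) p :=
    fun hf p => fderiv_apply_comm hf p _ _
  have cZT : ∀ {f}, ContDiff ℝ 2 f → ∀ p, pZ (pT f) p = pT (pZ f) p :=
    fun hf p => fderiv_apply_comm hf p _ _
  have e1 := fderiv_momentum (c₁ := 2 * Ω) (c₂ := -β) (c₃ := 0) (c₄ := 0) (c₅ := -1 / ρ₁)
    (dT hu) du (dX hu) dv (dY hu) dw (dZ hu) dw dv (dX hP)
    (fun p => by linear_combination heq1 p)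
  have e2 := fderiv_momentum (c₁ := 0) (c₂ := β) (c₃ := Ω ^ 2) (c₄ := 0) (c₅ := -1 / ρ₁)
    (dT hv) du (dX hv) dv (dY hv) dw (dZ hv) dw du (dY hP)
    (fun p => by linear_combination heq2 p)
  have e3 := fderiv_momentum (c₁ := -2 * Ω) (c₂ := 0) (c₃ := 0) (c₄ := g - Ω ^ 2 * R)
    (c₅ := -1 / ρ₁) (dT hw) du (dX hw) dv (dY hw) dw (dZ hw) du du (dZ hP)
    (fun p => by linear_combination heq3 p)
  have k1 := fderiv_sub_eq_const hvort1
  have k2 := fderiv_sub_eq_const hvort2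
  have k3 := fderiv_sub_eq_const hvort3
  -- the vorticity equation
  have tu : ∀ p, Λ₁ * pX u₁ p + (Λ₂ + 2 * Ω) * pY u₁ p + (Λ₃ + β * p.2.1) * pZ u₁ p
      = 0 * v₁ p := by
    intro p
    have a : pY (pT w₁) p + (u₁ p * pY (pX w₁) p + pX w₁ p * pY u₁ p)
        + (v₁ p * pY (pY w₁) p + pY w₁ p * pY v₁ p)
        + (w₁ p * pY (pZ w₁) p + pZ w₁ p * pY w₁ p) + -2 * Ω * pY u₁ p
        + 0 * (p.2.1 * pY u₁ p + u₁ p * 1) + 0 * 1 = -1 / ρ₁ * pY (pZ P₁) p := e3 p (0, 1, 0, 0)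
    have b : pZ (pT v₁) p + (u₁ p * pZ (pX v₁) p + pX v₁ p * pZ u₁ p)
        + (v₁ p * pZ (pY v₁) p + pY v₁ p * pZ v₁ p)
        + (w₁ p * pZ (pZ v₁) p + pZ v₁ p * pZ w₁ p) + 0 * pZ w₁ p
        + β * (p.2.1 * pZ u₁ p + u₁ p * 0) + Ω ^ 2 * 0 = -1 / ρ₁ * pZ (pY P₁) p :=
      e2 p (0, 0, 1, 0)
    have kx : pX (pY w₁) p = pX (pZ v₁) p := k1 p _
    have ky : pY (pY w₁) p = pY (pZ v₁) p := k1 p _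
    have kz : pZ (pY w₁) p = pZ (pZ v₁) p := k1 p _
    have kt : pT (pY w₁) p = pT (pZ v₁) p := k1 p _
    rw [cYT hw, cYX hw, ← cZY hw, ← cZY hP] at a
    rw [cZT hv, cZX hv, cZY hv] at b
    rw [kx, ky, kz, kt] at a
    linear_combination b - a + pY u₁ p * (-hvort2 p) - pZ u₁ p * hvort3 p
      + (pY v₁ p + pZ w₁ p) * hvort1 p + Λ₁ * hmass p
  have tv : ∀ p, Λ₁ * pX v₁ p + (Λ₂ + 2 * Ω) * pY v₁ p + (Λ₃ + β * p.2.1) * pZ v₁ p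
      = 0 * v₁ p := by
    intro p
    have a : pZ (pT u₁) p + (u₁ p * pZ (pX u₁) p + pX u₁ p * pZ u₁ p)
        + (v₁ p * pZ (pY u₁) p + pY u₁ p * pZ v₁ p)
        + (w₁ p * pZ (pZ u₁) p + pZ u₁ p * pZ w₁ p) + 2 * Ω * pZ w₁ p
        + -β * (p.2.1 * pZ v₁ p + v₁ p * 0) + 0 * 0 = -1 / ρ₁ * pZ (pX P₁) p := e1 p (0, 0, 1, 0)
    have b : pX (pT w₁) p + (u₁ p * pX (pX w₁) p + pX w₁ p * pX u₁ p)
        + (v₁ p * pX (pY w₁) p + pY w₁ p * pX v₁ p)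
        + (w₁ p * pX (pZ w₁) p + pZ w₁ p * pX w₁ p) + -2 * Ω * pX u₁ p
        + 0 * (p.2.1 * pX u₁ p + u₁ p * 0) + 0 * 0 = -1 / ρ₁ * pX (pZ P₁) p := e3 p (1, 0, 0, 0)
    have kx : pX (pZ u₁) p = pX (pX w₁) p := k2 p _
    have ky : pY (pZ u₁) p = pY (pX w₁) p := k2 p _
    have kz : pZ (pZ u₁) p = pZ (pX w₁) p := k2 p _
    have kt : pT (pZ u₁) p = pT (pX w₁) p := k2 p _
    rw [cZT hu, cZX hu, cZY hu, cZX hP] at a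
    rw [cXT hw, ← cYX hw, ← cZX hw] at b
    rw [kx, ky, kz, kt] at a
    linear_combination b - a - pZ v₁ p * hvort3 p - pX v₁ p * hvort1 p
      + (pX u₁ p + pZ w₁ p) * hvort2 p + (Λ₂ + 2 * Ω) * hmass p
  have tw : ∀ p, Λ₁ * pX w₁ p + (Λ₂ + 2 * Ω) * pY w₁ p + (Λ₃ + β * p.2.1) * pZ w₁ p
      = β * v₁ p := by
    intro p
    have a : pX (pT v₁) p + (u₁ p * pX (pX v₁) p + pX v₁ p * pX u₁ p)
        + (v₁ p * pX (pY v₁) p + pY v₁ p * pX v₁ p)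
        + (w₁ p * pX (pZ v₁) p + pZ v₁ p * pX w₁ p) + 0 * pX w₁ p
        + β * (p.2.1 * pX u₁ p + u₁ p * 0) + Ω ^ 2 * 0 = -1 / ρ₁ * pX (pY P₁) p :=
      e2 p (1, 0, 0, 0)
    have b : pY (pT u₁) p + (u₁ p * pY (pX u₁) p + pX u₁ p * pY u₁ p)
        + (v₁ p * pY (pY u₁) p + pY u₁ p * pY v₁ p)
        + (w₁ p * pY (pZ u₁) p + pZ u₁ p * pY w₁ p) + 2 * Ω * pY w₁ p
        + -β * (p.2.1 * pY v₁ p + v₁ p * 1) + 0 * 1 = -1 / ρ₁ * pY (pX P₁) p := e1 p (0, 1, 0, 0)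
    have kx : pX (pX v₁) p = pX (pY u₁) p := k3 p _
    have ky : pY (pX v₁) p = pY (pY u₁) p := k3 p _
    have kz : pZ (pX v₁) p = pZ (pY u₁) p := k3 p _
    have kt : pT (pX v₁) p = pT (pY u₁) p := k3 p _
    rw [cXT hv, ← cYX hv, ← cZX hv, ← cYX hP] at a
    rw [cYT hu, cYX hu, ← cZY hu] at b
    rw [kx, ky, kz, kt] at a
    linear_combination b - a - pX w₁ p * hvort1 p - pY w₁ p * hvort2 p
      + (pX u₁ p + pY v₁ p) * hvort3 p + (Λ₃ + β * p.2.1) * hmass p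
  have su := fderiv_transport_s8 (dX hu) (dY hu) (dZ hu) dv tu
  have sv := fderiv_transport_s8 (dX hv) (dY hv) (dZ hv) dv tv
  have sw := fderiv_transport_s8 (dX hw) (dY hw) (dZ hw) dv tw
  have uz : ∀ p, pZ u₁ p = 0 := by
    intro p
    have a : Λ₁ * pY (pX u₁) p + (Λ₂ + 2 * Ω) * pY (pY u₁) p + (Λ₃ + β * p.2.1) * pY (pZ u₁) p
        + β * 1 * pZ u₁ p = 0 * pY v₁ p := su p (0, 1, 0, 0)
    have b : Λ₁ * pX (pX v₁) p + (Λ₂ + 2 * Ω) * pX (pY v₁) p + (Λ₃ + β * p.2.1) * pX (pZ v₁) p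
        + β * 0 * pZ v₁ p = 0 * pX v₁ p := sv p (1, 0, 0, 0)
    have kx : pX (pX v₁) p = pX (pY u₁) p := k3 p _
    have ky : pY (pX v₁) p = pY (pY u₁) p := k3 p _
    have kz : pZ (pX v₁) p = pZ (pY u₁) p := k3 p _
    rw [cYX hu, ← cZY hu] at a
    rw [← cYX hv, ← cZX hv, kx, ky, kz] at b
    exact (mul_eq_zero_iff_left hβ.ne').mp (by linear_combination a - b)
  have vx : ∀ p, pX v₁ p = 0 := by
    intro p
    have a : Λ₁ * pZ (pX u₁) p + (Λ₂ + 2 * Ω) * pZ (pY u₁) p + (Λ₃ + β * p.2.1) * pZ (pZ u₁) p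
        + β * 0 * pZ u₁ p = 0 * pZ v₁ p := su p (0, 0, 1, 0)
    have b : Λ₁ * pX (pX w₁) p + (Λ₂ + 2 * Ω) * pX (pY w₁) p + (Λ₃ + β * p.2.1) * pX (pZ w₁) p
        + β * 0 * pZ w₁ p = β * pX v₁ p := sw p (1, 0, 0, 0)
    have kx : pX (pZ u₁) p = pX (pX w₁) p := k2 p _
    have ky : pY (pZ u₁) p = pY (pX w₁) p := k2 p _
    have kz : pZ (pZ u₁) p = pZ (pX w₁) p := k2 p _
    rw [cZX hu, cZY hu, kx, ky, kz] at a
    rw [← cYX hw, ← cZX hw] at b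
    exact (mul_eq_zero_iff_left hβ.ne').mp (by linear_combination a - b)
  have wz : ∀ p, pZ w₁ p = pY v₁ p := by
    intro p
    have a : Λ₁ * pZ (pX v₁) p + (Λ₂ + 2 * Ω) * pZ (pY v₁) p + (Λ₃ + β * p.2.1) * pZ (pZ v₁) p
        + β * 0 * pZ v₁ p = 0 * pZ v₁ p := sv p (0, 0, 1, 0)
    have b : Λ₁ * pY (pX w₁) p + (Λ₂ + 2 * Ω) * pY (pY w₁) p + (Λ₃ + β * p.2.1) * pY (pZ w₁) p
        + β * 1 * pZ w₁ p = β * pY v₁ p := sw p (0, 1, 0, 0)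
    have kx : pX (pY w₁) p = pX (pZ v₁) p := k1 p _
    have ky : pY (pY w₁) p = pY (pZ v₁) p := k1 p _
    have kz : pZ (pY w₁) p = pZ (pZ v₁) p := k1 p _
    rw [cZX hv, cZY hv] at a
    rw [cYX hw, ← cZY hw, kx, ky, kz] at b
    exact mul_left_cancel₀ hβ.ne' (by linear_combination b - a)
  have uy : ∀ p, pY u₁ p = -Λ₃ := fun p => by linarith [hvort3 p, vx p]
  have ux : ∀ p, pY v₁ p - (-1 / 2) * pX u₁ p = 0 := fun p => by linarith [hmass p, wz p]
  have kv := fderiv_sub_eq_const (g := fun q => (-1 / 2) * pX u₁ q) ux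
  have kvY : ∀ p, pY (pY v₁) p = 0 := by
    intro p
    have h1 : pY (pY v₁) p = fderiv ℝ (fun q => (-1 / 2) * pX u₁ q) p (0, 1, 0, 0) := kv p _
    have h2 : pY (pX u₁) p = 0 := by
      rw [cYX hu]; exact fderiv_apply_of_forall_eq uy p _
    rw [fderiv_const_mul (dX hu p)] at h1
    rw [h1]
    change (-1 / 2) * pY (pX u₁) p = 0
    rw [h2, mul_zero]
  have kvZ : ∀ p, pY (pZ v₁) p = 0 := by
    intro p
    have h1 : pZ (pY v₁) p = fderiv ℝ (fun q => (-1 / 2) * pX u₁ q) p (0, 0, 1, 0) := kv p _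
    have h2 : pZ (pX u₁) p = 0 := by
      rw [cZX hu]; exact fderiv_apply_of_forall_eq uz p _
    rw [fderiv_const_mul (dX hu p)] at h1
    rw [← cZY hv, h1]
    change (-1 / 2) * pZ (pX u₁) p = 0
    rw [h2, mul_zero]
  have vz : ∀ p, pZ v₁ p = 0 := by
    intro p
    have a : Λ₁ * pY (pX v₁) p + (Λ₂ + 2 * Ω) * pY (pY v₁) p + (Λ₃ + β * p.2.1) * pY (pZ v₁) p
        + β * 1 * pZ v₁ p = 0 * pY v₁ p := sv p (0, 1, 0, 0)
    have h2 : pY (pX v₁) p = 0 := fderiv_apply_of_forall_eq vx p _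
    rw [h2, kvY, kvZ] at a
    exact (mul_eq_zero_iff_left hβ.ne').mp (by linear_combination a)
  have vy : ∀ p, pY v₁ p = 0 := by
    intro p
    have a := tv p
    rw [vx, vz] at a
    exact (mul_eq_zero_iff_left hΩ).mp (by linear_combination a)
  have hΛ₁ : Λ₁ = 0 := by
    have a : pY w₁ (0, 0, -d, 0) = 0 :=
      fderiv_apply_eq_zero_of_line dw _ _ fun s => by simpa using hbot 0 s 0
    rw [← hvort1 (0, 0, -d, 0), a, vz, sub_zero]
  have hΛ₂ : Λ₂ = 0 := by
    have a : pX w₁ (0, 0, -d, 0) = 0 :=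
      fderiv_apply_eq_zero_of_line dw _ _ fun s => by simpa using hbot s 0 0
    rw [← hvort2 (0, 0, -d, 0), a, uz, sub_zero]
  have ux0 : ∀ p, pX u₁ p = 0 := fun p => by linarith [ux p, vy p]
  have uy0 : ∀ p, pY u₁ p = 0 := by
    intro p
    have a := tu p
    rw [ux0, uz] at a
    exact (mul_eq_zero_iff_left hΩ).mp (by linear_combination a)
  have wx : ∀ p, pX w₁ p = 0 := fun p => by linarith [hvort2 p, uz p]
  have wy : ∀ p, pY w₁ p = 0 := fun p => by linarith [hvort1 p, vz p]
  have wz0 : ∀ p, pZ w₁ p = 0 := fun p => (wz p).trans (vy p)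
  have v0 : ∀ p, v₁ p = 0 := by
    intro p
    have a := tw p
    rw [wx, wy, wz0] at a
    exact (mul_eq_zero_iff_left hβ.ne').mp (by linear_combination -a)
  have w0 : ∀ p, w₁ p = 0 := by
    rintro ⟨x, y, z, t⟩
    rw [eq_of_spatial_derivs_eq_zero dw wx wy wz0,
      ← eq_of_spatial_derivs_eq_zero dw wx wy wz0 0 0 (-d), hbot]
  have hPy : ∀ p, pY P₁ p = -ρ₁ * (β * u₁ p + Ω ^ 2) * p.2.1 := by
    intro p
    have a := heq2 p
    have b : pT v₁ p = 0 := fderiv_apply_of_forall_eq v0 p _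
    rw [b, vx, vy, vz] at a
    field_simp at a
    linear_combination a
  have hPz : ∀ p, pZ P₁ p = ρ₁ * (2 * Ω * u₁ p + Ω ^ 2 * R - g) := by
    intro p
    have a := heq3 p
    have b : pT w₁ p = 0 := fderiv_apply_of_forall_eq w0 p _
    rw [b, wx, wy, wz0] at a
    field_simp at a
    linear_combination a
  have u0 : ∀ p, u₁ p = -(Ω ^ 2) / β := by
    rintro ⟨x, y, z, t⟩
    obtain ⟨M, hM⟩ := hbound 0 t
    obtain ⟨N, hN⟩ := hηy
    rw [eq_of_spatial_derivs_eq_zero du ux0 uy0 uz]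
    set U := u₁ (0, 0, 0, t) with hU
    have hc : -ρ₁ * (β * U + Ω ^ 2) = 0 := by
      refine eq_zero_of_abs_mul_le
        (M := M + |ρ₁ * (2 * Ω * U + Ω ^ 2 * R - g)| * N) fun s => ?_
      have a := hM s
      rw [hPy, hPz, eq_of_spatial_derivs_eq_zero du ux0 uy0 uz, ← hU] at a
      have b := mul_le_mul_of_nonneg_left (hN (0, s, t))
        (abs_nonneg (ρ₁ * (2 * Ω * U + Ω ^ 2 * R - g)))
      rw [← abs_mul] at b
      have c := abs_sub (-ρ₁ * (β * U + Ω ^ 2) * s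
        + ρ₁ * (2 * Ω * U + Ω ^ 2 * R - g) * sY η₁ (0, s, t))
        (ρ₁ * (2 * Ω * U + Ω ^ 2 * R - g) * sY η₁ (0, s, t))
      rw [add_sub_cancel_right] at c
      linarith
    have hd : β * U + Ω ^ 2 = 0 := (mul_eq_zero_iff_left (neg_ne_zero.mpr hρ.ne')).mp hc
    rw [eq_div_iff hβ.ne']
    linear_combination hd
  refine ⟨u0, v0, w0, fun t => P₁ (0, 0, 0, t) / ρ₁, ?_⟩
  have hPx : ∀ p, pX P₁ p = 0 := by
    intro p
    have a := heq1 p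
    have b : pT u₁ p = 0 := fderiv_apply_of_forall_eq u0 p _
    rw [b, ux0, uy0, uz, v0, w0] at a
    field_simp at a
    linear_combination a
  have hPy0 : ∀ p, pY P₁ p = 0 := by
    intro p
    rw [hPy, u0]
    field_simp
    ring
  set K := ρ₁ * (Ω ^ 2 * R - g - 2 * Ω ^ 3 / β) with hK
  have hPzK : ∀ p, pZ P₁ p = K := by
    intro p
    rw [hPz, u0, hK]
    field_simp
    ring
  have dz : Differentiable ℝ (fun p : ℝ × ℝ × ℝ × ℝ => K * p.2.2.1) := by fun_prop
  have dPK : ∀ p e, fderiv ℝ (fun p => P₁ p - K * p.2.2.1) p e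
      = fderiv ℝ P₁ p e - K * e.2.2.1 := by
    intro p e
    have hz : HasFDerivAt (fun q : ℝ × ℝ × ℝ × ℝ => q.2.2.1)
        ((ContinuousLinearMap.fst ℝ ℝ ℝ).comp ((ContinuousLinearMap.snd ℝ ℝ (ℝ × ℝ)).comp
          (ContinuousLinearMap.snd ℝ ℝ (ℝ × ℝ × ℝ)))) p :=
      ((ContinuousLinearMap.fst ℝ ℝ ℝ).comp ((ContinuousLinearMap.snd ℝ ℝ (ℝ × ℝ)).comp
          (ContinuousLinearMap.snd ℝ ℝ (ℝ × ℝ × ℝ)))).hasFDerivAt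
    rw [((dP p).hasFDerivAt.fun_sub (hz.const_mul K)).fderiv]
    simp
  rintro ⟨x, y, z, t⟩
  have hconst := eq_of_spatial_derivs_eq_zero (dP.fun_sub dz)
    (fun p => (dPK p _).trans (by simpa [pX] using hPx p))
    (fun p => (dPK p _).trans (by simpa [pY] using hPy0 p))
    (fun p => (dPK p _).trans (by simpa [pZ, sub_eq_zero] using hPzK p)) x y z t
  simp only [mul_zero, sub_zero] at hconst
  have hc : ρ₁ * (P₁ (0, 0, 0, t) / ρ₁) = P₁ (0, 0, 0, t) := mul_div_cancel₀ _ hρ.ne'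
  change P₁ (x, y, z, t) = ρ₁ * ((Ω ^ 2 * R - g - 2 * Ω ^ 3 / β) * z + P₁ (0, 0, 0, t) / ρ₁)
  rw [mul_add, hc, ← mul_assoc, ← hK]
  linear_combination hconst
end
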